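/- arXiv:1905.01396 — 2 statements merged into one kernel-verified Lean document; each statement's English description precedes it below -/
import Mathlib

section
/- Let g = (g_{ij}) be a smooth field of symmetric invertible 2×2 matrices on an open set U ⊆ ℝ², with Christoffel symbols Γ^k_{ij} := ½ Σ_l g^{kl}(∂_i g_{lj} + ∂_j g_{li} − ∂_l g_{ij}). Let K = (K_{ij}) be a smooth field of symmetric 2×2 matrices on U with det(K(p)) ≠ 0 for all p ∈ U, such that for every C² geodesic γ : I → U of Γ, the function t ↦ Σ_{i,j} K_{ij}(γ(t))·(γ^i)′(t)(γ^j)′(t) is constant on I. Define ḡ_{ij} := (det(g)/det(K))² · K_{ij}. Then ḡ is a smooth field of symmetric invertible 2×2 matrices on U and there exists a smooth map α = (α_1, α_2) : U → ℝ² such that the Christoffel symbols Γ̄ of ḡ satisfy Γ̄^a_{bc} − Γ^a_{bc} = δ^a_b α_c + δ^a_c α_b for all a,b,c ∈ {1,2}. -/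
/-- Partial derivative `∂_i f` of a function on `ℝ²`. -/
noncomputable def pderiv' (f : (Fin 2 → ℝ) → ℝ) (i : Fin 2) (p : Fin 2 → ℝ) : ℝ :=
  fderiv ℝ f p (Pi.single i 1)

/-- The Christoffel symbols `Γ^k_{ij} = ½ Σ_l g^{kl}(∂_i g_{lj} + ∂_j g_{li} − ∂_l g_{ij})`
of a field `g` of invertible symmetric 2×2 matrices. -/
noncomputable def christoffel (g : (Fin 2 → ℝ) → Fin 2 → Fin 2 → ℝ)
    (k i j : Fin 2) (p : Fin 2 → ℝ) : ℝ :=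
  (1 / 2) * ∑ l, (Matrix.of (g p))⁻¹ k l *
    (pderiv' (fun q => g q l j) i p + pderiv' (fun q => g q l i) j p
      - pderiv' (fun q => g q i j) l p)

/-- The candidate projectively equivalent metric `ḡ = (det g / det K)² · K` built from
a nondegenerate Killing tensor `K` of a 2-dimensional metric `g`. -/
noncomputable def gbar (g K : (Fin 2 → ℝ) → Fin 2 → Fin 2 → ℝ)
    (p : Fin 2 → ℝ) (i j : Fin 2) : ℝ :=
  ((Matrix.of (g p)).det / (Matrix.of (K p)).det) ^ 2 * K p i j

open Matrix in
theorem christoffel_eq_of_pderiv {h : (Fin 2 → ℝ) → Fin 2 → Fin 2 → ℝ} {p : Fin 2 → ℝ}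
    (hdet : IsUnit (Matrix.of (h p)).det) (C : Fin 2 → Fin 2 → Fin 2 → ℝ)
    (hC : ∀ k i j, C k i j = C k j i)
    (hd : ∀ c i j, pderiv' (fun q => h q i j) c p
      = ∑ l, (h p i l * C l j c + h p j l * C l i c)) (k i j : Fin 2) :
    christoffel h k i j p = C k i j := by
  have key : (Matrix.of (h p))⁻¹ *ᵥ (Matrix.of (h p) *ᵥ fun m => C m i j) = fun m => C m i j := by
    rw [Matrix.mulVec_mulVec, Matrix.nonsing_inv_mul _ hdet, Matrix.one_mulVec]
  rw [← congrFun key k, christoffel, Matrix.mulVec, dotProduct, Finset.mul_sum]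
  refine Finset.sum_congr rfl fun l _ => ?_
  have e : (Matrix.of (h p) *ᵥ fun m => C m i j) l = ∑ m, h p l m * C m i j := rfl
  rw [e, hd, hd, hd]
  simp only [Fin.sum_univ_two]
  rw [hC 0 j i, hC 1 j i, hC 0 l i, hC 1 l i, hC 0 l j, hC 1 l j]
  ring

open Matrix in
theorem sum_mul_christoffel {h : (Fin 2 → ℝ) → Fin 2 → Fin 2 → ℝ} {p : Fin 2 → ℝ}
    (hdet : IsUnit (Matrix.of (h p)).det) (a i j : Fin 2) :
    ∑ k, h p a k * christoffel h k i j p =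
      (1 / 2) * (pderiv' (fun q => h q a j) i p + pderiv' (fun q => h q a i) j p
        - pderiv' (fun q => h q i j) a p) := by
  set b : Fin 2 → ℝ := fun l => (1 / 2) * (pderiv' (fun q => h q l j) i p
    + pderiv' (fun q => h q l i) j p - pderiv' (fun q => h q i j) l p) with hb
  have key : Matrix.of (h p) *ᵥ ((Matrix.of (h p))⁻¹ *ᵥ b) = b := by
    rw [Matrix.mulVec_mulVec, Matrix.mul_nonsing_inv _ hdet, Matrix.one_mulVec]
  change _ = b a
  rw [← congrFun key a, Matrix.mulVec, dotProduct]
  refine Finset.sum_congr rfl fun k _ => ?_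
  simp only [christoffel, Matrix.mulVec, dotProduct, hb, Matrix.of_apply, Finset.mul_sum]
  refine Finset.sum_congr rfl fun l _ => ?_
  ring

theorem pderiv'_congr_of_isOpen {U : Set (Fin 2 → ℝ)} (hU : IsOpen U) {f f' : (Fin 2 → ℝ) → ℝ}
    (hf : ∀ q ∈ U, f q = f' q) {p : Fin 2 → ℝ} (hp : p ∈ U) (c : Fin 2) :
    pderiv' f c p = pderiv' f' c p := by
  have : f =ᶠ[nhds p] f' := Filter.mem_of_superset (hU.mem_nhds hp) hf
  rw [pderiv', pderiv', this.fderiv_eq]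

theorem christoffel_comm {U : Set (Fin 2 → ℝ)} (hU : IsOpen U)
    {h : (Fin 2 → ℝ) → Fin 2 → Fin 2 → ℝ} (hsymm : ∀ p ∈ U, ∀ i j, h p i j = h p j i)
    {p : Fin 2 → ℝ} (hp : p ∈ U) (k i j : Fin 2) :
    christoffel h k i j p = christoffel h k j i p := by
  unfold christoffel
  congr 1
  refine Finset.sum_congr rfl fun l _ => ?_
  rw [pderiv'_congr_of_isOpen hU (fun q hq => hsymm q hq i j) hp l]
  ring

/-- Metric compatibility of the Christoffel symbols. -/
theorem pderiv'_eq_sum_christoffel {U : Set (Fin 2 → ℝ)} (hU : IsOpen U)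
    {h : (Fin 2 → ℝ) → Fin 2 → Fin 2 → ℝ} (hsymm : ∀ p ∈ U, ∀ i j, h p i j = h p j i)
    {p : Fin 2 → ℝ} (hp : p ∈ U) (hdet : IsUnit (Matrix.of (h p)).det) (c i j : Fin 2) :
    pderiv' (fun q => h q i j) c p =
      ∑ l, (h p i l * christoffel h l j c p + h p j l * christoffel h l i c p) := by
  rw [Finset.sum_add_distrib, sum_mul_christoffel hdet, sum_mul_christoffel hdet,
    pderiv'_congr_of_isOpen hU (fun q hq => hsymm q hq j i) hp c]
  ring

theorem contDiffOn_pderiv' {U : Set (Fin 2 → ℝ)} (hU : IsOpen U) {f : (Fin 2 → ℝ) → ℝ}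
    (hf : ContDiffOn ℝ (⊤ : ℕ∞) f U) (c : Fin 2) :
    ContDiffOn ℝ (⊤ : ℕ∞) (pderiv' f c) U :=
  (hf.fderiv_of_isOpen hU (by norm_cast)).clm_apply contDiffOn_const

theorem contDiffOn_det {U : Set (Fin 2 → ℝ)} {h : (Fin 2 → ℝ) → Fin 2 → Fin 2 → ℝ}
    (hh : ∀ i j, ContDiffOn ℝ (⊤ : ℕ∞) (fun p => h p i j) U) :
    ContDiffOn ℝ (⊤ : ℕ∞) (fun p => (Matrix.of (h p)).det) U := by
  simp only [Matrix.det_fin_two, Matrix.of_apply]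
  exact ((hh 0 0).mul (hh 1 1)).sub ((hh 0 1).mul (hh 1 0))

theorem contDiffOn_christoffel {U : Set (Fin 2 → ℝ)} (hU : IsOpen U)
    {h : (Fin 2 → ℝ) → Fin 2 → Fin 2 → ℝ}
    (hh : ∀ i j, ContDiffOn ℝ (⊤ : ℕ∞) (fun p => h p i j) U)
    (hdet : ∀ p ∈ U, (Matrix.of (h p)).det ≠ 0) (k i j : Fin 2) :
    ContDiffOn ℝ (⊤ : ℕ∞) (christoffel h k i j) U := by
  have hinv : ∀ l, ContDiffOn ℝ (⊤ : ℕ∞) (fun p => (Matrix.of (h p))⁻¹ k l) U := by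
    intro l
    simp only [Matrix.inv_def, Ring.inverse_eq_inv', Matrix.smul_apply, smul_eq_mul,
      Matrix.adjugate_fin_two]
    refine ((contDiffOn_det hh).inv hdet).mul ?_
    fin_cases k <;> fin_cases l <;> simp [hh, ContDiffOn.neg]
  unfold christoffel
  exact contDiffOn_const.mul <| ContDiffOn.sum fun l _ => (hinv l).mul <|
    ((contDiffOn_pderiv' hU (hh l j) i).add (contDiffOn_pderiv' hU (hh l i) j)).sub
      (contDiffOn_pderiv' hU (hh i j) l)

theorem exists_geodesic {U : Set (Fin 2 → ℝ)} (hU : IsOpen U)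
    {G : Fin 2 → Fin 2 → Fin 2 → (Fin 2 → ℝ) → ℝ}
    (hG : ∀ k i j, ContDiffOn ℝ 1 (G k i j) U)
    {p : Fin 2 → ℝ} (hp : p ∈ U) (v : Fin 2 → ℝ) :
    ∃ ε > (0 : ℝ), ∃ γ γ' γ'' : ℝ → Fin 2 → ℝ, γ 0 = p ∧ γ' 0 = v ∧
      ∀ t ∈ Set.Ioo (-ε) ε, γ t ∈ U ∧
        (∀ k, HasDerivAt (fun τ => γ τ k) (γ' t k) t) ∧
        (∀ k, HasDerivAt (fun τ => γ' τ k) (γ'' t k) t) ∧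
        ∀ k, γ'' t k + ∑ i, ∑ j, G k i j (γ t) * γ' t i * γ' t j = 0 := by
  set F : (Fin 2 → ℝ) × (Fin 2 → ℝ) → (Fin 2 → ℝ) × (Fin 2 → ℝ) := fun x =>
    (x.2, fun k => -∑ i, ∑ j, G k i j x.1 * x.2 i * x.2 j)
  have hcoord : ∀ i, ContDiffAt ℝ 1 (fun x : (Fin 2 → ℝ) × (Fin 2 → ℝ) => x.2 i) (p, v) :=
    fun i => (contDiff_apply ℝ ℝ i).contDiffAt.comp _ contDiffAt_snd
  have hsmooth : ContDiffAt ℝ 1 F (p, v) := by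
    refine contDiffAt_snd.prodMk (contDiffAt_pi.2 fun k => ?_)
    refine (ContDiffAt.sum fun i _ => ContDiffAt.sum fun j _ => ?_).neg
    refine ContDiffAt.mul (ContDiffAt.mul ?_ (hcoord i)) (hcoord j)
    exact ((hG k i j).contDiffAt (hU.mem_nhds hp)).comp (p, v) contDiffAt_fst
  obtain ⟨r, hr, ε, hε, hsol⟩ :=
    hsmooth.exists_forall_mem_closedBall_exists_eq_forall_mem_Ioo_hasDerivAt 0
  obtain ⟨α, hα0, hα⟩ := hsol (p, v) (Metric.mem_closedBall_self hr.le)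
  simp only [zero_sub, zero_add] at hα
  have hcont : ContinuousAt (fun t => (α t).1) 0 :=
    (hα 0 ⟨neg_lt_zero.2 hε, hε⟩).continuousAt.fst
  obtain ⟨δ, hδ, hδU⟩ := Metric.mem_nhds_iff.1
    (hcont.preimage_mem_nhds (hU.mem_nhds (by simpa [hα0] using hp)))
  refine ⟨min ε δ, lt_min hε hδ, fun t => (α t).1, fun t => (α t).2, fun t => (F (α t)).2,
    by simp [hα0], by simp [hα0], fun t ht => ?_⟩
  have hd := hα t ⟨(neg_le_neg (min_le_left _ _)).trans_lt ht.1, ht.2.trans_le (min_le_left _ _)⟩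
  refine ⟨hδU ?_, hasDerivAt_pi.1 hd.fst, hasDerivAt_pi.1 hd.snd, fun k => neg_add_cancel _⟩
  rw [Metric.mem_ball, Real.dist_0_eq_abs, abs_lt]
  exact ⟨(neg_le_neg (min_le_right _ _)).trans_lt ht.1, ht.2.trans_le (min_le_right _ _)⟩

theorem fderiv_apply_eq_pderiv' (f : (Fin 2 → ℝ) → ℝ) (p v : Fin 2 → ℝ) :
    fderiv ℝ f p v = ∑ c, pderiv' f c p * v c := by
  have hv : v = ∑ c, v c • (Pi.single c 1 : Fin 2 → ℝ) := by
    ext i; fin_cases i <;> simp [Fin.sum_univ_two]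
  conv_lhs => rw [hv]
  simp [pderiv', mul_comm]

/-- The Killing equation, as a cubic form in the velocity. -/
theorem killing_equation {U : Set (Fin 2 → ℝ)} (hU : IsOpen U)
    {G : Fin 2 → Fin 2 → Fin 2 → (Fin 2 → ℝ) → ℝ}
    (hG : ∀ k i j, ContDiffOn ℝ 1 (G k i j) U)
    {K : (Fin 2 → ℝ) → Fin 2 → Fin 2 → ℝ}
    (hK : ∀ i j, DifferentiableOn ℝ (fun p => K p i j) U)
    (hint : ∀ (I : Set ℝ), IsOpen I → I.OrdConnected →
      ∀ (γ γ' γ'' : ℝ → Fin 2 → ℝ),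
        (∀ t ∈ I, γ t ∈ U) →
        (∀ t ∈ I, ∀ k, HasDerivAt (fun τ => γ τ k) (γ' t k) t) →
        (∀ t ∈ I, ∀ k, HasDerivAt (fun τ => γ' τ k) (γ'' t k) t) →
        (∀ t ∈ I, ∀ k, γ'' t k + ∑ i, ∑ j, G k i j (γ t) * γ' t i * γ' t j = 0) →
        ∀ t₁ ∈ I, ∀ t₂ ∈ I,
          (∑ i, ∑ j, K (γ t₁) i j * γ' t₁ i * γ' t₁ j) =
          (∑ i, ∑ j, K (γ t₂) i j * γ' t₂ i * γ' t₂ j))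
    {p : Fin 2 → ℝ} (hp : p ∈ U) (v : Fin 2 → ℝ) :
    ∑ i, ∑ j, ((∑ c, pderiv' (fun q => K q i j) c p * v c) * v i * v j
      - K p i j * (∑ a, ∑ b, G i a b p * v a * v b) * v j
      - K p i j * v i * ∑ a, ∑ b, G j a b p * v a * v b) = 0 := by
  obtain ⟨ε, hε, γ, γ', γ'', h0, h0', hγ⟩ := exists_geodesic hU hG hp v
  have hmem : (0 : ℝ) ∈ Set.Ioo (-ε) ε := ⟨neg_lt_zero.2 hε, hε⟩
  have hconst := hint (Set.Ioo (-ε) ε) isOpen_Ioo Set.ordConnected_Ioo γ γ' γ''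
    (fun t ht => (hγ t ht).1) (fun t ht => (hγ t ht).2.1) (fun t ht => (hγ t ht).2.2.1)
    (fun t ht => (hγ t ht).2.2.2)
  obtain ⟨-, hd, hd', hgeo⟩ := hγ 0 hmem
  have hzero : HasDerivAt (fun t => ∑ i, ∑ j, K (γ t) i j * γ' t i * γ' t j) 0 0 := by
    refine (hasDerivAt_const (0 : ℝ)
      (∑ i, ∑ j, K (γ 0) i j * γ' 0 i * γ' 0 j)).congr_of_eventuallyEq ?_
    filter_upwards [isOpen_Ioo.mem_nhds hmem] with t ht using hconst t ht 0 hmem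
  have hKd : ∀ i j, HasDerivAt (fun t => K (γ t) i j)
      (∑ c, pderiv' (fun q => K q i j) c p * v c) 0 := by
    intro i j
    rw [← fderiv_apply_eq_pderiv', ← h0']
    have := ((hK i j).differentiableAt (hU.mem_nhds hp)).hasFDerivAt
    exact this.comp_hasDerivAt_of_eq (0 : ℝ) (hasDerivAt_pi.2 hd) h0.symm
  have hsum : HasDerivAt (fun t => ∑ i, ∑ j, K (γ t) i j * γ' t i * γ' t j) _ 0 :=
    HasDerivAt.fun_sum fun i _ => HasDerivAt.fun_sum fun j _ =>
      ((hKd i j).mul (hd' i)).mul (hd' j)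
  rw [← hsum.unique hzero]
  have hacc : ∀ k, γ'' 0 k = -∑ i, ∑ j, G k i j p * v i * v j := fun k => by
    have := hgeo k
    rw [h0, h0'] at this
    linarith
  refine Finset.sum_congr rfl fun i _ => Finset.sum_congr rfl fun j _ => ?_
  simp only [hacc, h0, h0', Pi.mul_apply]
  ring

/-- With `α_c = tr Γ_c - ½ ∂_c log |det K|`, the cubic Killing equation determines
the full covariant derivative of `K`. -/
theorem killing_covariant_deriv {K : Fin 2 → Fin 2 → ℝ} {dK C : Fin 2 → Fin 2 → Fin 2 → ℝ}
    {α : Fin 2 → ℝ} (hK : K 1 0 = K 0 1) (hdK : ∀ c, dK c 1 0 = dK c 0 1)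
    (hC : ∀ k, C k 1 0 = C k 0 1) (hdet : K 0 0 * K 1 1 - K 0 1 * K 1 0 ≠ 0)
    (hα : ∀ c, 2 * (K 0 0 * K 1 1 - K 0 1 * K 1 0) * α c =
      2 * (C 0 0 c + C 1 1 c) * (K 0 0 * K 1 1 - K 0 1 * K 1 0)
        - (dK c 0 0 * K 1 1 + K 0 0 * dK c 1 1 - dK c 0 1 * K 1 0 - K 0 1 * dK c 1 0))
    (hkill : ∀ v : Fin 2 → ℝ, ∑ i, ∑ j, ((∑ c, dK c i j * v c) * v i * v j
      - K i j * (∑ a, ∑ b, C i a b * v a * v b) * v j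
      - K i j * v i * ∑ a, ∑ b, C j a b * v a * v b) = 0) (c i j : Fin 2) :
    dK c i j = ∑ l, (K i l * C l j c + K j l * C l i c)
      - 2 * K i j * α c + K i c * α j + K j c * α i := by
  have e1 := hkill ![1, 0]
  have e2 := hkill ![0, 1]
  have e3 := hkill ![1, 1]
  have e4 := hkill ![1, -1]
  have ac := hα c
  have ai := hα i
  have aj := hα j
  simp only [Fin.sum_univ_two, Matrix.cons_val_zero, Matrix.cons_val_one, hK, hdK, hC]
    at e1 e2 e3 e4 hdet ac ai aj ⊢
  have k0 : dK 0 0 0 = 2 * (K 0 0 * C 0 0 0 + K 0 1 * C 1 0 0) := by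
    linarith
  have k1 : dK 1 1 1 = 2 * (K 0 1 * C 0 1 1 + K 1 1 * C 1 1 1) := by
    linarith
  have k2 : dK 1 0 0 = 2 * (K 0 1 * C 0 0 0 + K 1 1 * C 1 0 0)
      + 4 * (K 0 0 * C 0 0 1 + K 0 1 * C 1 0 1) - 2 * dK 0 0 1 := by
    linarith
  have k3 : dK 0 1 1 = 2 * (K 0 0 * C 0 1 1 + K 0 1 * C 1 1 1)
      + 4 * (K 0 1 * C 0 0 1 + K 1 1 * C 1 0 1) - 2 * dK 1 0 1 := by
    linarith
  refine mul_left_cancel₀ hdet ?_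
  fin_cases c <;> fin_cases i <;> fin_cases j <;>
    simp only [Fin.zero_eta, Fin.mk_one, hK, hdK, hC, k0, k1, k2, k3]
      at ac ai aj ⊢
  · linear_combination K 0 0 * ac - K 0 0 * ai / 2 - K 0 0 * aj / 2
  · linear_combination K 0 1 * ac - K 0 0 * aj / 2 - K 0 1 * ai / 2
  · linear_combination K 0 1 * ac - K 0 1 * aj / 2 - K 0 0 * ai / 2
  · linear_combination K 1 1 * ac - K 0 1 * aj / 2 - K 0 1 * ai / 2
  · linear_combination K 0 0 * ac - K 0 1 * aj / 2 - K 0 1 * ai / 2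
  · linear_combination K 0 1 * ac - K 0 1 * aj / 2 - K 1 1 * ai / 2
  · linear_combination K 0 1 * ac - K 1 1 * aj / 2 - K 0 1 * ai / 2
  · linear_combination K 1 1 * ac - K 1 1 * aj / 2 - K 1 1 * ai / 2

theorem pderiv'_mul {f f' : (Fin 2 → ℝ) → ℝ} {p : Fin 2 → ℝ} (hf : DifferentiableAt ℝ f p)
    (hf' : DifferentiableAt ℝ f' p) (c : Fin 2) :
    pderiv' (fun q => f q * f' q) c p = pderiv' f c p * f' p + f p * pderiv' f' c p := by
  simp only [pderiv', fderiv_fun_mul hf hf', add_apply,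
    smul_apply, smul_eq_mul]
  ring

theorem pderiv'_det {h : (Fin 2 → ℝ) → Fin 2 → Fin 2 → ℝ} {p : Fin 2 → ℝ}
    (hh : ∀ i j, DifferentiableAt ℝ (fun q => h q i j) p) (c : Fin 2) :
    pderiv' (fun q => (Matrix.of (h q)).det) c p =
      pderiv' (fun q => h q 0 0) c p * h p 1 1 + h p 0 0 * pderiv' (fun q => h q 1 1) c p
      - pderiv' (fun q => h q 0 1) c p * h p 1 0 - h p 0 1 * pderiv' (fun q => h q 1 0) c p := by
  have e : pderiv' (fun q => (Matrix.of (h q)).det) c p =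
      pderiv' (fun q => h q 0 0 * h q 1 1) c p - pderiv' (fun q => h q 0 1 * h q 1 0) c p := by
    simp only [Matrix.det_fin_two, Matrix.of_apply, pderiv']
    rw [fderiv_fun_sub ((hh 0 0).fun_mul (hh 1 1)) ((hh 0 1).fun_mul (hh 1 0))]
    rfl
  rw [e, pderiv'_mul (hh 0 0) (hh 1 1), pderiv'_mul (hh 0 1) (hh 1 0)]
  ring

theorem differentiableAt_div' {f f' : (Fin 2 → ℝ) → ℝ} {p : Fin 2 → ℝ}
    (hf : DifferentiableAt ℝ f p) (hf' : DifferentiableAt ℝ f' p) (h0' : f' p ≠ 0) :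
    DifferentiableAt ℝ (fun q => f q / f' q) p := by
  simpa only [div_eq_mul_inv] using hf.fun_mul (hf'.fun_inv h0')

theorem pderiv'_sq_div {f f' : (Fin 2 → ℝ) → ℝ} {p : Fin 2 → ℝ} (hf : DifferentiableAt ℝ f p)
    (hf' : DifferentiableAt ℝ f' p) (h0 : f p ≠ 0) (h0' : f' p ≠ 0) (c : Fin 2) :
    pderiv' (fun q => (f q / f' q) ^ 2) c p =
      2 * (f p / f' p) ^ 2 * (pderiv' f c p / f p - pderiv' f' c p / f' p) := by
  have hg : DifferentiableAt ℝ (fun q => f q / f' q) p :=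
    differentiableAt_div' hf hf' h0'
  have hmul := pderiv'_mul hg hf' c
  have hcancel : pderiv' (fun q => f q / f' q * f' q) c p = pderiv' f c p := by
    have : (fun q => f q / f' q * f' q) =ᶠ[nhds p] f := by
      filter_upwards [hf'.continuousAt.eventually_ne h0'] with q hq using div_mul_cancel₀ _ hq
    rw [pderiv', this.fderiv_eq, pderiv']
  rw [hcancel] at hmul
  simp only [sq]
  rw [pderiv'_mul hg hg, hmul]
  field_simp
  ring

/-- The 2-dimensional converse of the Topalov–Matveev theorem: if `K` is a nondegenerate
second-order Killing tensor of a 2-dimensional metric `g`, then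
`ḡ = (det g / det K)² · K` is a metric projectively equivalent to `g`. -/
theorem stmt_11
    (U : Set (Fin 2 → ℝ)) (hU : IsOpen U)
    (g : (Fin 2 → ℝ) → Fin 2 → Fin 2 → ℝ)
    (hg_smooth : ∀ i j, ContDiffOn ℝ (⊤ : ℕ∞) (fun p => g p i j) U)
    (hg_symm : ∀ p ∈ U, ∀ i j, g p i j = g p j i)
    (hg_inv : ∀ p ∈ U, IsUnit (Matrix.of (g p)).det)
    (K : (Fin 2 → ℝ) → Fin 2 → Fin 2 → ℝ)
    (hK_smooth : ∀ i j, ContDiffOn ℝ (⊤ : ℕ∞) (fun p => K p i j) U)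
    (hK_symm : ∀ p ∈ U, ∀ i j, K p i j = K p j i)
    (hK_det : ∀ p ∈ U, (Matrix.of (K p)).det ≠ 0)
    (hK_int : ∀ (I : Set ℝ), IsOpen I → I.OrdConnected →
      ∀ (γ γ' γ'' : ℝ → Fin 2 → ℝ),
        (∀ t ∈ I, γ t ∈ U) →
        (∀ t ∈ I, ∀ k, HasDerivAt (fun τ => γ τ k) (γ' t k) t) →
        (∀ t ∈ I, ∀ k, HasDerivAt (fun τ => γ' τ k) (γ'' t k) t) →
        (∀ t ∈ I, ∀ k,
          γ'' t k + ∑ i, ∑ j, christoffel g k i j (γ t) * γ' t i * γ' t j = 0) →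
        ∀ t₁ ∈ I, ∀ t₂ ∈ I,
          (∑ i, ∑ j, K (γ t₁) i j * γ' t₁ i * γ' t₁ j) =
          (∑ i, ∑ j, K (γ t₂) i j * γ' t₂ i * γ' t₂ j)) :
    (∀ i j, ContDiffOn ℝ (⊤ : ℕ∞) (fun p => gbar g K p i j) U) ∧
    (∀ p ∈ U, ∀ i j, gbar g K p i j = gbar g K p j i) ∧
    (∀ p ∈ U, IsUnit (Matrix.of (gbar g K p)).det) ∧
    ∃ α : (Fin 2 → ℝ) → Fin 2 → ℝ,
      (∀ i, ContDiffOn ℝ (⊤ : ℕ∞) (fun p => α p i) U) ∧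
      ∀ p ∈ U, ∀ a b c : Fin 2,
        christoffel (gbar g K) a b c p - christoffel g a b c p =
          (if a = b then 1 else 0) * α p c + (if a = c then 1 else 0) * α p b := by
  have hg_det : ∀ p ∈ U, (Matrix.of (g p)).det ≠ 0 := fun p hp => (hg_inv p hp).ne_zero
  have hdg := contDiffOn_det hg_smooth
  have hdK := contDiffOn_det hK_smooth
  have hbar_det : ∀ p ∈ U, IsUnit (Matrix.of (gbar g K p)).det := by
    intro p hp
    have e : Matrix.of (gbar g K p) =
        ((Matrix.of (g p)).det / (Matrix.of (K p)).det) ^ 2 • Matrix.of (K p) := rfl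
    rw [e, Matrix.det_smul, isUnit_iff_ne_zero]
    exact mul_ne_zero (pow_ne_zero _ (pow_ne_zero _ (div_ne_zero (hg_det p hp) (hK_det p hp))))
      (hK_det p hp)
  refine ⟨fun i j => ((hdg.div hdK hK_det).pow 2).mul (hK_smooth i j),
    fun p hp i j => by rw [gbar, gbar, hK_symm p hp], hbar_det,
    fun p c => (1 / 2) *
      (pderiv' (fun q => (Matrix.of (g q)).det) c p / (Matrix.of (g p)).det
        - pderiv' (fun q => (Matrix.of (K q)).det) c p / (Matrix.of (K p)).det),
    fun c => contDiffOn_const.mul <|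
      ((contDiffOn_pderiv' hU hdg c).div hdg hg_det).sub
        ((contDiffOn_pderiv' hU hdK c).div hdK hK_det), ?_⟩
  intro p hp a b c
  set α : Fin 2 → ℝ := fun c => (1 / 2) *
    (pderiv' (fun q => (Matrix.of (g q)).det) c p / (Matrix.of (g p)).det
      - pderiv' (fun q => (Matrix.of (K q)).det) c p / (Matrix.of (K p)).det) with hα
  have diffAt : ∀ {f : (Fin 2 → ℝ) → ℝ}, ContDiffOn ℝ (⊤ : ℕ∞) f U → DifferentiableAt ℝ f p :=
    fun hf => (hf.contDiffAt (hU.mem_nhds hp)).differentiableAt (by simp)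
  have hcomm := christoffel_comm hU hg_symm hp
  have hgdet : ∀ c, pderiv' (fun q => (Matrix.of (g q)).det) c p =
      2 * (christoffel g 0 0 c p + christoffel g 1 1 c p) * (Matrix.of (g p)).det := by
    intro c
    rw [pderiv'_det (fun i j => diffAt (hg_smooth i j))]
    simp only [pderiv'_eq_sum_christoffel hU hg_symm hp (hg_inv p hp), Fin.sum_univ_two,
      Matrix.det_fin_two, Matrix.of_apply, hg_symm p hp 1 0]
    ring
  have hcov := killing_covariant_deriv (K := K p) (α := α)
    (dK := fun c i j => pderiv' (fun q => K q i j) c p)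
    (C := fun k i j => christoffel g k i j p) (hK_symm p hp 1 0)
    (fun c => pderiv'_congr_of_isOpen hU (fun q hq => hK_symm q hq 1 0) hp c)
    (fun k => hcomm k 1 0) (by simpa [Matrix.det_fin_two] using hK_det p hp)
    (fun c => by
      have hD := hK_det p hp
      have hD' := hg_det p hp
      have e := pderiv'_det (fun i j => diffAt (hK_smooth i j)) c
      have e' : K p 0 0 * K p 1 1 - K p 0 1 * K p 1 0 = (Matrix.of (K p)).det := by
        simp [Matrix.det_fin_two]
      rw [e', ← e]
      simp only [hα, hgdet]
      field_simp)
    (killing_equation hU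
      (fun k i j => (contDiffOn_christoffel hU hg_smooth hg_det k i j).of_le (by norm_cast))
      (fun i j => (hK_smooth i j).differentiableOn (by simp)) hK_int hp)
  rw [sub_eq_iff_eq_add]
  refine christoffel_eq_of_pderiv (hbar_det p hp)
    (fun a b c => (if a = b then 1 else 0) * α c + (if a = c then 1 else 0) * α b
      + christoffel g a b c p) (fun k i j => by rw [hcomm k i j]; ring) (fun c i j => ?_) a b c
  simp only [gbar]
  rw [pderiv'_mul ((differentiableAt_div' (diffAt hdg) (diffAt hdK) (hK_det p hp)).fun_pow 2)
    (diffAt (hK_smooth i j)), pderiv'_sq_div (diffAt hdg) (diffAt hdK) (hg_det p hp)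
    (hK_det p hp), hcov c i j]
  have hαc : pderiv' (fun q => (Matrix.of (g q)).det) c p / (Matrix.of (g p)).det
      - pderiv' (fun q => (Matrix.of (K q)).det) c p / (Matrix.of (K p)).det = 2 * α c := by
    simp only [hα]; ring
  rw [hαc]
  clear_value α
  generalize ((Matrix.of (g p)).det / (Matrix.of (K p)).det) ^ 2 = φ
  have hs := hK_symm p hp 1 0
  fin_cases c <;> fin_cases i <;> fin_cases j <;> simp [Fin.sum_univ_two, hs] <;> ring
end

section
/- Let g = (g_{ij}) be a smooth field of symmetric invertible 2×2 matrices on an open set U ⊆ ℝ² with coordinates (x,y), with Christoffel symbols Γ^k_{ij} := ½ Σ_l g^{kl}(∂_i g_{lj} + ∂_j g_{li} − ∂_l g_{ij}). Define f₀ := −Γ²₁₁, f₁ := Γ¹₁₁ − 2Γ²₁₂, f₂ := 2Γ¹₁₂ − Γ²₂₂, f₃ := Γ¹₂₂, and let σ := |det(g)|^{1/3}·g⁻¹ with entries σ¹¹, σ¹² = σ²¹, σ²². Then the following four identities hold on U: (1) ∂ₓσ²² − (2/3)·f₁·σ²² − 2f₀·σ¹² = 0; (2) ∂_yσ²² − 2∂ₓσ¹²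 − (4/3)·f₂·σ²² − (2/3)·f₁·σ¹² + 2f₀·σ¹¹ = 0; (3) −2∂_yσ¹² + ∂ₓσ¹¹ − 2f₃·σ²² + (2/3)·f₂·σ¹² + (4/3)·f₁·σ¹¹ = 0; (4) ∂_yσ¹¹ + 2f₃·σ¹² + (2/3)·f₂·σ¹¹ = 0. -/
/-- The weighted inverse metric `σ = |det g|^{1/3}·g⁻¹`. -/
noncomputable def sigma' (g : (Fin 2 → ℝ) → Fin 2 → Fin 2 → ℝ)
    (p : Fin 2 → ℝ) (i j : Fin 2) : ℝ :=
  |(Matrix.of (g p)).det| ^ ((1 : ℝ) / 3) * (Matrix.of (g p))⁻¹ i j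

theorem hasFDerivAt_abs_rpow_mul_inv_mul {E : Type*} [NormedAddCommGroup E] [NormedSpace ℝ E]
    {d w : E → ℝ} {d' w' : E →L[ℝ] ℝ} {p : E} (r : ℝ) (hd : HasFDerivAt d d' p)
    (hw : HasFDerivAt w w' p) (h0 : d p ≠ 0) :
    HasFDerivAt (fun q => |d q| ^ r * ((d q)⁻¹ * w q))
      (|d p| ^ r • ((d p)⁻¹ • w' + ((r - 1) * (d p)⁻¹ ^ 2 * w p) • d')) p := by
  have hpow : HasFDerivAt (fun q => |d q| ^ r) ((r * (d p)⁻¹ * |d p| ^ r) • d') p := by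
    have hexp : ∀ q, d q ≠ 0 → |d q| ^ r = Real.exp (Real.log (d q) * r) := fun q hq => by
      rw [Real.rpow_def_of_pos (abs_pos.2 hq), Real.log_abs]
    have h := ((hd.log h0).mul_const r).exp
    rw [← hexp p h0] at h
    refine (h.congr_of_eventuallyEq ?_).congr_fderiv ?_
    · filter_upwards [hd.continuousAt.eventually_ne h0] with q hq using hexp q hq
    · ext v
      simp
      ring
  have hinv : HasFDerivAt (fun q => (d q)⁻¹) (-((d p)⁻¹ ^ 2) • d') p := by
    refine ((hasDerivAt_inv h0).comp_hasFDerivAt p hd).congr_fderiv ?_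
    ext v
    simp
  refine (hpow.mul (hinv.mul hw)).congr_fderiv ?_
  ext v
  simp
  ring

theorem inv_of_fin_two (a : Fin 2 → Fin 2 → ℝ) (i j : Fin 2) :
    (Matrix.of a)⁻¹ i j =
      (Matrix.of a).det⁻¹ * !![a 1 1, -a 0 1; -a 1 0, a 0 0] i j := by
  rw [Matrix.inv_def, Matrix.adjugate_fin_two]
  simp

theorem pderiv'_sigma' {g : (Fin 2 → ℝ) → Fin 2 → Fin 2 → ℝ} {p : Fin 2 → ℝ}
    (hg : ∀ i j, DifferentiableAt ℝ (fun q => g q i j) p)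
    (h0 : (Matrix.of (g p)).det ≠ 0) (i j k : Fin 2) :
    pderiv' (fun q => sigma' g q i j) k p =
      |(Matrix.of (g p)).det| ^ ((1 : ℝ) / 3) *
        ((Matrix.of (g p)).det⁻¹ *
          !![pderiv' (fun q => g q 1 1) k p, -pderiv' (fun q => g q 0 1) k p;
            -pderiv' (fun q => g q 1 0) k p, pderiv' (fun q => g q 0 0) k p] i j
        - 2 / 3 * (Matrix.of (g p)).det⁻¹ ^ 2 *
          !![g p 1 1, -g p 0 1; -g p 1 0, g p 0 0] i j *
          (pderiv' (fun q => g q 0 0) k p * g p 1 1 + g p 0 0 * pderiv' (fun q => g q 1 1) k p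
            - pderiv' (fun q => g q 0 1) k p * g p 1 0
            - g p 0 1 * pderiv' (fun q => g q 1 0) k p)) := by
  have hd : HasFDerivAt (fun q => (Matrix.of (g q)).det)
      (g p 0 0 • fderiv ℝ (fun q => g q 1 1) p + g p 1 1 • fderiv ℝ (fun q => g q 0 0) p
        - (g p 0 1 • fderiv ℝ (fun q => g q 1 0) p
          + g p 1 0 • fderiv ℝ (fun q => g q 0 1) p)) p := by
    simp only [Matrix.det_fin_two, Matrix.of_apply]
    exact ((hg 0 0).hasFDerivAt.mul (hg 1 1).hasFDerivAt).sub
      ((hg 0 1).hasFDerivAt.mul (hg 1 0).hasFDerivAt)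
  have hw : HasFDerivAt (fun q => !![g q 1 1, -g q 0 1; -g q 1 0, g q 0 0] i j)
      (!![fderiv ℝ (fun q => g q 1 1) p, -fderiv ℝ (fun q => g q 0 1) p;
        -fderiv ℝ (fun q => g q 1 0) p, fderiv ℝ (fun q => g q 0 0) p] i j) p := by
    fin_cases i <;> fin_cases j
    · exact (hg 1 1).hasFDerivAt
    · exact (hg 0 1).hasFDerivAt.neg
    · exact (hg 1 0).hasFDerivAt.neg
    · exact (hg 0 0).hasFDerivAt
  have h := (hasFDerivAt_abs_rpow_mul_inv_mul (1 / 3) hd hw h0).fderiv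
  simp only [pderiv', sigma', inv_of_fin_two]
  rw [h]
  fin_cases i <;> fin_cases j <;> simp <;> ring

/-- The linear metrizability system (Liouville–Bryant–Eastwood–Matveev): the weighted
inverse `σ = |det g|^{1/3} g⁻¹` of a 2-dimensional metric `g` satisfies the four linear
PDEs with coefficients `f₀ = −Γ²₁₁`, `f₁ = Γ¹₁₁ − 2Γ²₁₂`, `f₂ = 2Γ¹₁₂ − Γ²₂₂`,
`f₃ = Γ¹₂₂` of the projective connection of `g`. -/
theorem stmt_18
    (U : Set (Fin 2 → ℝ)) (hU : IsOpen U)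
    (g : (Fin 2 → ℝ) → Fin 2 → Fin 2 → ℝ)
    (hg_smooth : ∀ i j, ContDiffOn ℝ (⊤ : ℕ∞) (fun p => g p i j) U)
    (hg_symm : ∀ p ∈ U, ∀ i j, g p i j = g p j i)
    (hg_inv : ∀ p ∈ U, IsUnit (Matrix.of (g p)).det)
    (f₀ f₁ f₂ f₃ : (Fin 2 → ℝ) → ℝ)
    (hf₀ : ∀ p, f₀ p = -christoffel g 1 0 0 p)
    (hf₁ : ∀ p, f₁ p = christoffel g 0 0 0 p - 2 * christoffel g 1 0 1 p)
    (hf₂ : ∀ p, f₂ p = 2 * christoffel g 0 0 1 p - christoffel g 1 1 1 p)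
    (hf₃ : ∀ p, f₃ p = christoffel g 0 1 1 p) :
    ∀ p ∈ U,
      (pderiv' (fun q => sigma' g q 1 1) 0 p
          - (2 / 3) * f₁ p * sigma' g p 1 1 - 2 * f₀ p * sigma' g p 0 1 = 0) ∧
      (pderiv' (fun q => sigma' g q 1 1) 1 p - 2 * pderiv' (fun q => sigma' g q 0 1) 0 p
          - (4 / 3) * f₂ p * sigma' g p 1 1 - (2 / 3) * f₁ p * sigma' g p 0 1
          + 2 * f₀ p * sigma' g p 0 0 = 0) ∧
      (-2 * pderiv' (fun q => sigma' g q 0 1) 1 p + pderiv' (fun q => sigma' g q 0 0) 0 p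
          - 2 * f₃ p * sigma' g p 1 1 + (2 / 3) * f₂ p * sigma' g p 0 1
          + (4 / 3) * f₁ p * sigma' g p 0 0 = 0) ∧
      (pderiv' (fun q => sigma' g q 0 0) 1 p + 2 * f₃ p * sigma' g p 0 1
          + (2 / 3) * f₂ p * sigma' g p 0 0 = 0) := by
  intro p hp
  have hnhds : U ∈ nhds p := hU.mem_nhds hp
  have hdiff : ∀ i j, DifferentiableAt ℝ (fun q => g q i j) p := fun i j =>
    ((hg_smooth i j).contDiffAt hnhds).differentiableAt (by simp)
  have h0 : (Matrix.of (g p)).det ≠ 0 := (hg_inv p hp).ne_zero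
  have hsymm : g p 1 0 = g p 0 1 := hg_symm p hp 1 0
  have hdsymm : ∀ k, pderiv' (fun q => g q 1 0) k p = pderiv' (fun q => g q 0 1) k p := by
    intro k
    have h : (fun q => g q 1 0) =ᶠ[nhds p] fun q => g q 0 1 := by
      filter_upwards [hnhds] with q hq using hg_symm q hq 1 0
    rw [pderiv', pderiv', h.fderiv_eq]
  simp only [hf₀, hf₁, hf₂, hf₃, pderiv'_sigma' hdiff h0]
  simp only [christoffel, sigma', inv_of_fin_two, Fin.sum_univ_two, hdsymm, hsymm]
  simp only [Matrix.of_apply, Matrix.cons_val', Matrix.cons_val_zero, Matrix.cons_val_one,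
    Matrix.cons_val_fin_one]
  have hdet : (Matrix.of (g p)).det = g p 0 0 * g p 1 1 - g p 0 1 * g p 0 1 := by
    rw [Matrix.det_fin_two]
    simp [hsymm]
  generalize |(Matrix.of (g p)).det| ^ ((1 : ℝ) / 3) = s
  generalize (Matrix.of (g p)).det = d at h0 hdet ⊢
  refine ⟨?_, ?_, ?_, ?_⟩ <;> field_simp <;> rw [hdet] <;> ring
end
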